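/- For every positive integer t one has a^tC = a^tR* ∩ C, and the inclusions induce ring isomorphisms R/a^tR = U/a^tU = C/a^tC = A/a^tA = R*/a^tR*. Consequently the (a)-adic completions of U, of C, and of A are all equal to R*, and a lies in the Jacobson radical of C. -/

import Mathlib

set_option synthInstance.maxHeartbeats 1000000
set_option maxHeartbeats 1000000
noncomputable section
namespace HRWGen

variable (R : Type) [CommRing R] [IsDomain R] [IsNoetherianRing R] (a : R)

/-- `R* `, the `(a)`-adic completion of `R`. -/
abbrev RstarG := AdicCompletion (Ideal.span {a}) R

/-- The image of `a` in `R*`. -/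
def aS : RstarG R a := algebraMap R (RstarG R a) a

variable {h : ℕ} (cc : Fin h → ℕ → R) (tau : Fin h → RstarG R a)
  (taue : Fin h → ℕ → RstarG R a)

/-- `U_r = R[τ_{1r}, …, τ_{hr}]`. -/
def Ur (r : ℕ) : Subalgebra R (RstarG R a) :=
  Algebra.adjoin R (Set.range fun i => taue i r)

/-- `C_r = (1 + aU_r)^{-1} U_r`, realized inside `R*` by adjoining the inverses of the
elements `1 + a·u`, `u ∈ U_r` (all of which are units of the `(a)`-adically complete
ring `R*`). -/
def Cr (r : ℕ) : Subalgebra R (RstarG R a) :=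
  Algebra.adjoin R ((Set.range fun i => taue i r) ∪
    {w | ∃ u ∈ Algebra.adjoin R (Set.range fun i => taue i r),
      w * (1 + aS R a * u) = 1})

/-- `U = ∪_r U_r`. -/
def UU : Subalgebra R (RstarG R a) := ⨆ r, Ur R a taue r

/-- `C = ∪_r C_r`. -/
def CC : Subalgebra R (RstarG R a) := ⨆ r, Cr R a taue r

/-- The hypotheses: `a` is a nonzero nonunit, `h ≥ 1`, the `τ_i` are algebraically
independent over `R` (equivalently over `K`), `τ_{i0} = τ_i`, and the endpieces satisfy
`a^r τ_{ir} = τ_i - Σ_{j=1}^r c_{ij} a^j` (in particular `τ_i = Σ_{j≥1} c_{ij} a^j ∈ aR[[a]]`). -/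
structure SetupG (cc : Fin h → ℕ → R) (tau : Fin h → RstarG R a)
    (taue : Fin h → ℕ → RstarG R a) : Prop where
  hh : 0 < h
  ha0 : a ≠ 0
  hau : ¬ IsUnit a
  hind : AlgebraicIndependent R tau
  he0 : ∀ i, taue i 0 = tau i
  hrec : ∀ i r, aS R a ^ r * taue i r =
    tau i - algebraMap R (RstarG R a) (∑ j ∈ Finset.Icc 1 r, cc i j * a ^ j)

/-- The total quotient ring of `R*`. -/
abbrev QRstar := FractionRing (RstarG R a)

/-- The image of `R[τ_1,…,τ_h]` in the total quotient ring of `R*`. -/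
def polyImg : Subring (QRstar R a) :=
  Subring.closure
    (Set.range ((algebraMap (RstarG R a) (QRstar R a)).comp (algebraMap R (RstarG R a))) ∪
      Set.range fun i => algebraMap (RstarG R a) (QRstar R a) (tau i))

/-- The field `K(τ_1,…,τ_h)` inside the total quotient ring of `R*`. -/
def Ktau : Subring (QRstar R a) :=
  Subring.closure ((polyImg R a tau : Set (QRstar R a)) ∪
    {q | ∃ s ∈ polyImg R a tau, q * s = 1})

/-- `A = K(τ_1,…,τ_h) ∩ R*`. -/
def AG : Subring (RstarG R a) :=
  (Ktau R a tau).comap (algebraMap (RstarG R a) (QRstar R a))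

section

set_option linter.unusedSectionVars false

/-! ### Completions of subrings with the same quotients -/

/-- If `B` is complete for the ideal generated by `i b`, and `i : S → B` induces isomorphisms
`S/b^n ≃ B/(i b)^n` for all `n`, then `B` is the `(b)`-adic completion of `S`. -/
theorem nonempty_adicCompletion_equiv {S B : Type} [CommRing S] [CommRing B] (i : S →+* B) (b : S)
    [IsAdicComplete (Ideal.span {i b}) B]
    (hker : ∀ n x, i b ^ n ∣ i x → b ^ n ∣ x)
    (hsurj : ∀ n y, ∃ x, i b ^ n ∣ y - i x) :
    Nonempty (AdicCompletion (Ideal.span {b}) S ≃+* B) := by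
  set I : Ideal S := Ideal.span {b} with hI
  set J : Ideal B := Ideal.span {i b} with hJ
  have memI : ∀ n x, x ∈ I ^ n ↔ b ^ n ∣ x := fun n x => by
    rw [hI, Ideal.span_singleton_pow, Ideal.mem_span_singleton]
  have memJ : ∀ n y, y ∈ J ^ n ↔ i b ^ n ∣ y := fun n y => by
    rw [hJ, Ideal.span_singleton_pow, Ideal.mem_span_singleton]
  have hle : ∀ n, I ^ n ≤ (J ^ n).comap i := fun n x hx => by
    rw [Ideal.mem_comap, memJ, ← map_pow]
    exact map_dvd i ((memI n x).1 hx)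
  let f : (n : ℕ) → AdicCompletion I S →+* B ⧸ J ^ n := fun n =>
    (Ideal.quotientMap (J ^ n) i (hle n)).comp (AdicCompletion.evalₐ I n : _ →+* S ⧸ I ^ n)
  have f_mk : ∀ n (s : AdicCompletion.AdicCauchySequence I S),
      f n (AdicCompletion.mk I S s) = Ideal.Quotient.mk (J ^ n) (i (s.val n)) := fun n s => by
    simp [f]
  have hf : ∀ {m n : ℕ} (hmn : m ≤ n), (Ideal.Quotient.factorPow J hmn).comp (f n) = f m := by
    intro m n hmn
    ext x
    induction x using AdicCompletion.induction_on with
    | _ s =>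
      rw [RingHom.comp_apply, f_mk, f_mk]
      change Ideal.Quotient.mk (J ^ m) _ = _
      rw [Ideal.Quotient.eq, ← map_sub]
      apply hle m
      rw [← Ideal.Quotient.eq]
      exact AdicCompletion.Ideal.mk_eq_mk I hmn s
  let F := IsAdicComplete.liftRingHom J f hf
  have hF : ∀ n x, Ideal.Quotient.mk (J ^ n) (F x) = f n x :=
    fun n x => IsAdicComplete.mk_liftRingHom J f hf n x
  refine ⟨RingEquiv.ofBijective F ⟨?_, ?_⟩⟩
  · rw [injective_iff_map_eq_zero]
    intro x hx
    refine AdicCompletion.ext_evalₐ fun n => ?_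
    have h0 := hF n x
    rw [hx, map_zero] at h0
    induction x using AdicCompletion.induction_on with
    | _ s =>
      rw [f_mk, eq_comm, Ideal.Quotient.eq_zero_iff_mem, memJ] at h0
      rw [AdicCompletion.evalₐ_mk, map_zero, Ideal.Quotient.eq_zero_iff_mem, memI]
      exact hker n _ h0
  · intro y
    choose s hs using fun n => hsurj n y
    have hc : AdicCompletion.IsAdicCauchy I S s := by
      intro m n hmn
      rw [SModEq.sub_mem, smul_eq_mul, Ideal.mul_top, memI]
      refine hker m _ ?_
      have := dvd_sub ((pow_dvd_pow (i b) hmn).trans (hs n)) (hs m)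
      rwa [sub_sub_sub_cancel_left, ← map_sub] at this
    obtain ⟨c, rfl⟩ : ∃ c : AdicCompletion.AdicCauchySequence I S, c.val = s := ⟨⟨s, hc⟩, rfl⟩
    refine ⟨AdicCompletion.mk I S c, ?_⟩
    rw [← sub_eq_zero]
    refine IsHausdorff.haus (I := J) inferInstance _ fun n => ?_
    rw [SModEq.zero, smul_eq_mul, Ideal.mul_top, ← Ideal.Quotient.eq_zero_iff_mem, map_sub, hF,
      f_mk, ← map_sub, Ideal.Quotient.eq_zero_iff_mem, memJ, ← neg_sub, dvd_neg]
    exact hs n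

/-- An injective ring map closed under division by `i b` is closed under division by powers. -/
theorem pow_dvd_of_pow_dvd_map {S B : Type} [CommRing S] [CommRing B] (i : S →+* B)
    (hi : Function.Injective i) (b : S) (hdiv : ∀ y, i b * y ∈ i.range → y ∈ i.range)
    (n : ℕ) (x : S) (h : i b ^ n ∣ i x) : b ^ n ∣ x := by
  have key : ∀ n y, i b ^ n * y ∈ i.range → y ∈ i.range := by
    intro n
    induction n with
    | zero => intro y hy; simpa using hy
    | succ n ih => intro y hy; exact hdiv y (ih _ (by rwa [← mul_assoc, ← pow_succ]))
  obtain ⟨y, hy⟩ := h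
  obtain ⟨z, rfl⟩ := key n y ⟨x, hy⟩
  exact ⟨z, hi (by rw [hy, map_mul, map_pow])⟩

/-- Surjectivity and kernel of the composite `S → B → B/(i b)^t`. -/
theorem surjective_and_ker_comp {S B D : Type} [CommRing S] [CommRing B] [CommRing D]
    (i : S →+* B) (b : S) (t : ℕ) (hker : ∀ x, i b ^ t ∣ i x → b ^ t ∣ x)
    (hsurj : ∀ y, ∃ x, i b ^ t ∣ y - i x) (π : B →+* D) (hπ : Function.Surjective π)
    (hπk : RingHom.ker π = Ideal.span {i b ^ t}) :
    Function.Surjective (π.comp i) ∧ RingHom.ker (π.comp i) = Ideal.span {b ^ t} := by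
  have mem : ∀ y, π y = 0 ↔ i b ^ t ∣ y := fun y => by
    rw [← RingHom.mem_ker, hπk, Ideal.mem_span_singleton]
  refine ⟨fun d => ?_, ?_⟩
  · obtain ⟨y, rfl⟩ := hπ d
    obtain ⟨x, hx⟩ := hsurj y
    rw [← mem, map_sub, sub_eq_zero] at hx
    exact ⟨x, hx.symm⟩
  · ext x
    rw [RingHom.mem_ker, RingHom.comp_apply, mem, Ideal.mem_span_singleton]
    refine ⟨hker x, fun h => ?_⟩
    rw [← map_pow]
    exact map_dvd i h

/-! ### The completion `R*` -/

theorem mem_ker_evalₐ_iff (t : ℕ) (y : RstarG R a) :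
    AdicCompletion.evalₐ (Ideal.span {a}) t y = 0 ↔ aS R a ^ t ∣ y := by
  have hfg : (Ideal.span {a}).FG := ⟨{a}, by simp⟩
  have h1 := AdicCompletion.pow_smul_top_eq_ker_eval (M := R) (n := t) hfg
  have h2 : AdicCompletion.evalₐ (Ideal.span {a}) t y = 0 ↔
      y ∈ (AdicCompletion.eval (Ideal.span {a}) R t).ker := by
    rw [LinearMap.mem_ker, ← AdicCompletion.factor_evalₐ_eq_eval _ _ (by simp)]
    refine ⟨fun h => by rw [h, map_zero], fun h => ?_⟩
    rw [AdicCompletion.factor_evalₐ_eq_eval] at h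
    rw [← AdicCompletion.factor_eval_eq_evalₐ _ _ (by simp), h, map_zero]
  rw [h2, ← h1, Ideal.span_singleton_pow, Submodule.ideal_span_singleton_smul,
    Submodule.mem_smul_pointwise_iff_exists]
  simp only [Submodule.mem_top, true_and, Algebra.smul_def, map_pow]
  exact exists_congr fun z => eq_comm

instance isAdicComplete_span_aS : IsAdicComplete (Ideal.span {aS R a}) (RstarG R a) := by
  have h : Ideal.span {aS R a} = (Ideal.span {a}).map (algebraMap R (RstarG R a)) := by
    rw [Ideal.map_span, Set.image_singleton, aS]
  rw [h, IsAdicComplete.map_algebraMap_iff]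
  exact AdicCompletion.isAdicComplete ⟨{a}, by simp⟩

theorem exists_pow_dvd_sub_algebraMap (t : ℕ) (y : RstarG R a) :
    ∃ r : R, aS R a ^ t ∣ y - algebraMap R (RstarG R a) r := by
  obtain ⟨r, hr⟩ := Ideal.Quotient.mk_surjective (AdicCompletion.evalₐ (Ideal.span {a}) t y)
  refine ⟨r, (mem_ker_evalₐ_iff R a t _).1 ?_⟩
  rw [map_sub, AdicCompletion.algebraMap_apply, AdicCompletion.evalₐ_of, Algebra.algebraMap_self,
    RingHom.id_apply, hr, sub_self]

theorem pow_dvd_of_pow_dvd_algebraMap (t : ℕ) (r : R)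
    (hr : aS R a ^ t ∣ algebraMap R (RstarG R a) r) : a ^ t ∣ r := by
  rwa [← mem_ker_evalₐ_iff, AdicCompletion.algebraMap_apply, AdicCompletion.evalₐ_of,
    Algebra.algebraMap_self, RingHom.id_apply, Ideal.Quotient.eq_zero_iff_mem,
    Ideal.span_singleton_pow, Ideal.mem_span_singleton] at hr

variable {R a} in
theorem aS_mem_nonZeroDivisors (ha : a ≠ 0) : aS R a ∈ nonZeroDivisors (RstarG R a) := by
  have h := Module.Flat.isSMulRegular_of_nonZeroDivisors (M := RstarG R a)
    (mem_nonZeroDivisors_of_ne_zero ha)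
  rw [mem_nonZeroDivisors_iff_right]
  intro x hx
  refine h ?_
  simp only [smul_zero]
  rw [Algebra.smul_def, mul_comm]
  exact hx

theorem exists_one_add_aS_mul_inv (u : RstarG R a) : ∃ v, v * (1 + aS R a * u) = 1 := by
  have h := IsAdicComplete.le_jacobson_bot (Ideal.span {aS R a})
    (Ideal.mem_span_singleton_self (aS R a))
  obtain ⟨v, hv⟩ := (Ideal.mem_jacobson_bot.1 h u).exists_left_inv
  exact ⟨v, by rw [add_comm, hv]⟩

/-! ### The rings `U` and `C` -/

theorem UU_eq : UU R a taue = Algebra.adjoin R (⋃ r, Set.range fun i => taue i r) := by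
  rw [Algebra.adjoin_iUnion]; rfl

variable {R a cc tau taue}

theorem SetupG.aS_mul_cancel (hs : SetupG R a cc tau taue) {x y : RstarG R a}
    (h : aS R a * x = aS R a * y) : x = y :=
  (mul_cancel_left_mem_nonZeroDivisors (aS_mem_nonZeroDivisors hs.ha0)).1 h

theorem SetupG.taue_succ (hs : SetupG R a cc tau taue) (i : Fin h) (r : ℕ) :
    taue i r = aS R a * taue i (r + 1) + algebraMap R (RstarG R a) (cc i (r + 1) * a) := by
  have h0 := hs.hrec i r
  have h1 := hs.hrec i (r + 1)
  rw [Finset.sum_Icc_succ_top (by omega), map_add, ← sub_sub, ← h0] at h1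
  refine (mul_cancel_left_mem_nonZeroDivisors
    (pow_mem (aS_mem_nonZeroDivisors hs.ha0) r)).1 ?_
  simp only [map_mul, map_pow] at h1 ⊢
  change _ = _ - _ * aS R a ^ (r + 1) at h1
  change _ = _ * (_ + _ * aS R a)
  linear_combination -h1

theorem SetupG.monotone_Ur (hs : SetupG R a cc tau taue) : Monotone (Ur R a taue) := by
  refine monotone_nat_of_le_succ fun r => Algebra.adjoin_le ?_
  rintro _ ⟨i, rfl⟩
  simp only [SetLike.mem_coe]
  rw [hs.taue_succ i r]
  exact add_mem (mul_mem (algebraMap_mem _ _) (Algebra.subset_adjoin ⟨i, rfl⟩))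
    (algebraMap_mem _ _)

theorem SetupG.exists_mem_Ur (hs : SetupG R a cc tau taue) {u : RstarG R a}
    (hu : u ∈ UU R a taue) : ∃ r, u ∈ Ur R a taue r := by
  have := Subalgebra.coe_iSup_of_directed hs.monotone_Ur.directed_le
  have hu' : u ∈ ((⨆ r, Ur R a taue r : Subalgebra R (RstarG R a)) : Set (RstarG R a)) := hu
  rw [this] at hu'
  simpa using hu'

theorem aS_mem_UU : aS R a ∈ UU R a taue := algebraMap_mem _ _

theorem SetupG.exists_eq_algebraMap_add (hs : SetupG R a cc tau taue) {u : RstarG R a}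
    (hu : u ∈ UU R a taue) :
    ∃ r : R, ∃ v ∈ UU R a taue, u = algebraMap R (RstarG R a) r + aS R a * v := by
  have key : ∀ x ∈ Algebra.adjoin R (⋃ r, Set.range fun i => taue i r),
      ∃ r : R, ∃ v ∈ UU R a taue, x = algebraMap R (RstarG R a) r + aS R a * v := by
    intro x hx
    induction hx using Algebra.adjoin_induction with
    | mem x hx =>
      obtain ⟨r, i, rfl⟩ := Set.mem_iUnion.1 hx
      refine ⟨cc i (r + 1) * a, taue i (r + 1), ?_, ?_⟩
      · rw [UU_eq]
        exact Algebra.subset_adjoin (Set.mem_iUnion.2 ⟨r + 1, i, rfl⟩)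
      · rw [add_comm]
        exact hs.taue_succ i r
    | algebraMap r => exact ⟨r, 0, zero_mem _, by simp⟩
    | add x y _ _ ihx ihy =>
      obtain ⟨r, u, hu, rfl⟩ := ihx
      obtain ⟨s, v, hv, rfl⟩ := ihy
      exact ⟨r + s, u + v, add_mem hu hv, by rw [map_add]; ring⟩
    | mul x y _ _ ihx ihy =>
      obtain ⟨r, u, hu, rfl⟩ := ihx
      obtain ⟨s, v, hv, rfl⟩ := ihy
      refine ⟨r * s, r • v + s • u + aS R a * (u * v), ?_, ?_⟩
      · exact add_mem (add_mem (Subalgebra.smul_mem _ hv r) (Subalgebra.smul_mem _ hu s))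
          (mul_mem aS_mem_UU (mul_mem hu hv))
      · rw [map_mul, Algebra.smul_def, Algebra.smul_def]; ring
  exact key u (by rwa [← UU_eq])

theorem SetupG.mem_UU_of_aS_mul_mem (hs : SetupG R a cc tau taue) {y : RstarG R a}
    (hy : aS R a * y ∈ UU R a taue) : y ∈ UU R a taue := by
  obtain ⟨r, v, hv, h⟩ := hs.exists_eq_algebraMap_add hy
  have hr : aS R a ^ 1 ∣ algebraMap R (RstarG R a) r :=
    ⟨y - v, by rw [pow_one, mul_sub, h]; ring⟩
  obtain ⟨s, rfl⟩ := pow_dvd_of_pow_dvd_algebraMap R a 1 r hr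
  have : y = algebraMap R (RstarG R a) s + v := by
    apply hs.aS_mul_cancel
    rw [h, pow_one, map_mul, mul_add]
    rfl
  rw [this]
  exact add_mem (algebraMap_mem _ _) hv

theorem UU_le_CC : UU R a taue ≤ CC R a taue :=
  iSup_mono fun _ => Algebra.adjoin_mono Set.subset_union_left

theorem SetupG.inv_mem_CC (hs : SetupG R a cc tau taue) {u w : RstarG R a}
    (hu : u ∈ UU R a taue) (hw : w * (1 + aS R a * u) = 1) : w ∈ CC R a taue := by
  obtain ⟨r, hr⟩ := hs.exists_mem_Ur hu
  exact le_iSup (Cr R a taue) r (Algebra.subset_adjoin (Or.inr ⟨u, hr, hw⟩))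

theorem exists_mul_one_add_eq_of_mem_CC {x : RstarG R a} (hx : x ∈ CC R a taue) :
    ∃ u ∈ UU R a taue, ∃ v ∈ UU R a taue, x * (1 + aS R a * v) = u := by
  unfold CC Cr at hx
  rw [← Algebra.adjoin_iUnion] at hx
  induction hx using Algebra.adjoin_induction with
  | mem x hx =>
    obtain ⟨r, hx⟩ := Set.mem_iUnion.1 hx
    rcases hx with ⟨i, rfl⟩ | ⟨u, hu, hw⟩
    · exact ⟨taue i r, le_iSup (Ur R a taue) r (Algebra.subset_adjoin ⟨i, rfl⟩), 0, zero_mem _,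
        by simp⟩
    · exact ⟨1, one_mem _, u, le_iSup (Ur R a taue) r hu, hw⟩
  | algebraMap r => exact ⟨_, algebraMap_mem _ r, 0, zero_mem _, by simp⟩
  | add x y _ _ ihx ihy =>
    obtain ⟨u, hu, v, hv, h1⟩ := ihx
    obtain ⟨u', hu', v', hv', h2⟩ := ihy
    refine ⟨u * (1 + aS R a * v') + u' * (1 + aS R a * v), ?_, v + v' + aS R a * (v * v'), ?_, ?_⟩
    · exact add_mem (mul_mem hu (add_mem (one_mem _) (mul_mem aS_mem_UU hv')))
        (mul_mem hu' (add_mem (one_mem _) (mul_mem aS_mem_UU hv)))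
    · exact add_mem (add_mem hv hv') (mul_mem aS_mem_UU (mul_mem hv hv'))
    · rw [← h1, ← h2]; ring
  | mul x y _ _ ihx ihy =>
    obtain ⟨u, hu, v, hv, h1⟩ := ihx
    obtain ⟨u', hu', v', hv', h2⟩ := ihy
    refine ⟨u * u', mul_mem hu hu', v + v' + aS R a * (v * v'), ?_, ?_⟩
    · exact add_mem (add_mem hv hv') (mul_mem aS_mem_UU (mul_mem hv hv'))
    · rw [← h1, ← h2]; ring

theorem SetupG.mem_CC_of_aS_mul_mem (hs : SetupG R a cc tau taue) {y : RstarG R a}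
    (hy : aS R a * y ∈ CC R a taue) : y ∈ CC R a taue := by
  obtain ⟨u, hu, v, hv, h1⟩ := exists_mul_one_add_eq_of_mem_CC hy
  obtain ⟨w, hw⟩ := exists_one_add_aS_mul_inv R a v
  have h2 : y * (1 + aS R a * v) ∈ UU R a taue := by
    refine hs.mem_UU_of_aS_mul_mem ?_
    rwa [← mul_assoc, h1]
  have h3 : y = y * (1 + aS R a * v) * w := by linear_combination -y * hw
  rw [h3]
  exact mul_mem (UU_le_CC h2) (hs.inv_mem_CC hv hw)

theorem SetupG.mem_jacobson_CC (hs : SetupG R a cc tau taue) (w : CC R a taue)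
    (hw : (w : RstarG R a) = aS R a) : w ∈ (⊥ : Ideal (CC R a taue)).jacobson := by
  rw [Ideal.mem_jacobson_bot]
  rintro ⟨c, hc⟩
  obtain ⟨u, hu, v, hv, h1⟩ := exists_mul_one_add_eq_of_mem_CC hc
  obtain ⟨z, hz⟩ := exists_one_add_aS_mul_inv R a (u + v)
  have hz' := hs.inv_mem_CC (add_mem hu hv) hz
  have hv' : 1 + aS R a * v ∈ CC R a taue :=
    UU_le_CC (add_mem (one_mem _) (mul_mem aS_mem_UU hv))
  refine IsUnit.of_mul_eq_one (⟨_, mul_mem hv' hz'⟩ : CC R a taue) (Subtype.ext ?_)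
  change ((w : RstarG R a) * c + 1) * ((1 + aS R a * v) * z) = 1
  rw [hw]
  linear_combination hz + aS R a * z * h1

/-! ### The ring `A` -/

theorem polyImg_le_Ktau : polyImg R a tau ≤ Ktau R a tau :=
  fun _ hx => Subring.subset_closure (Or.inl hx)

theorem algebraMap_mem_polyImg (r : R) :
    algebraMap (RstarG R a) (QRstar R a) (algebraMap R (RstarG R a) r) ∈ polyImg R a tau :=
  Subring.subset_closure (Or.inl ⟨r, rfl⟩)

theorem algebraMap_mem_AG (r : R) : algebraMap R (RstarG R a) r ∈ AG R a tau :=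
  polyImg_le_Ktau (algebraMap_mem_polyImg r)

theorem mem_AG_of_aS_mul_mem (ha : a ≠ 0) {y : RstarG R a} (hy : aS R a * y ∈ AG R a tau) :
    y ∈ AG R a tau := by
  obtain ⟨q, hq⟩ := (IsLocalization.map_units (QRstar R a)
    ⟨aS R a, aS_mem_nonZeroDivisors ha⟩).exists_left_inv
  have hqK : q ∈ Ktau R a tau :=
    Subring.subset_closure (Or.inr ⟨_, algebraMap_mem_polyImg a, hq⟩)
  have h : algebraMap (RstarG R a) (QRstar R a) (aS R a * y) ∈ Ktau R a tau := hy
  have h2 : algebraMap (RstarG R a) (QRstar R a) y =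
      q * algebraMap (RstarG R a) (QRstar R a) (aS R a * y) := by
    rw [map_mul, ← mul_assoc, hq, one_mul]
  change algebraMap (RstarG R a) (QRstar R a) y ∈ Ktau R a tau
  rw [h2]
  exact mul_mem hqK h

end

theorem statement5 (R : Type) [CommRing R] [IsDomain R] [IsNoetherianRing R] (a : R)
    {h : ℕ} (cc : Fin h → ℕ → R) (tau : Fin h → RstarG R a)
    (taue : Fin h → ℕ → RstarG R a) (hs : SetupG R a cc tau taue) :
    -- `a^t C = a^t R* ∩ C`
    (∀ t : ℕ, 0 < t →
      Ideal.span {w : ↥(CC R a taue) | (w : RstarG R a) = aS R a ^ t} =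
        Ideal.comap (CC R a taue).val (Ideal.span {aS R a ^ t})) ∧
    -- the inclusions induce isomorphisms
    -- `R/a^tR = U/a^tU = C/a^tC = A/a^tA = R*/a^tR*`
    (∀ t : ℕ, 0 < t →
      ∀ (D : Type) [CommRing D] (π : RstarG R a →+* D), Function.Surjective π →
        RingHom.ker π = Ideal.span {aS R a ^ t} →
        (Function.Surjective (π.comp (algebraMap R (RstarG R a))) ∧
          RingHom.ker (π.comp (algebraMap R (RstarG R a))) = Ideal.span {a ^ t}) ∧
        (Function.Surjective (π.comp ((UU R a taue).val : ↥(UU R a taue) →ₐ[R] RstarG R a).toRingHom) ∧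
          RingHom.ker (π.comp ((UU R a taue).val).toRingHom) =
            Ideal.span {w : ↥(UU R a taue) | (w : RstarG R a) = aS R a ^ t}) ∧
        (Function.Surjective (π.comp ((CC R a taue).val).toRingHom) ∧
          RingHom.ker (π.comp ((CC R a taue).val).toRingHom) =
            Ideal.span {w : ↥(CC R a taue) | (w : RstarG R a) = aS R a ^ t}) ∧
        (Function.Surjective (π.comp (AG R a tau).subtype) ∧
          RingHom.ker (π.comp (AG R a tau).subtype) =
            Ideal.span {w : ↥(AG R a tau) | (w : RstarG R a) = aS R a ^ t})) ∧
    -- the `(a)`-adic completions of `U`, `C` and `A` all equal `R*`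
    Nonempty ((AdicCompletion
        (Ideal.span {w : ↥(UU R a taue) | (w : RstarG R a) = aS R a}) ↥(UU R a taue)) ≃+*
      RstarG R a) ∧
    Nonempty ((AdicCompletion
        (Ideal.span {w : ↥(CC R a taue) | (w : RstarG R a) = aS R a}) ↥(CC R a taue)) ≃+*
      RstarG R a) ∧
    Nonempty ((AdicCompletion
        (Ideal.span {w : ↥(AG R a tau) | (w : RstarG R a) = aS R a}) ↥(AG R a tau)) ≃+*
      RstarG R a) ∧
    -- `a` lies in the Jacobson radical of `C`
    (∀ w : ↥(CC R a taue), (w : RstarG R a) = aS R a →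
      w ∈ (⊥ : Ideal ↥(CC R a taue)).jacobson) := by
  let bU : UU R a taue := ⟨aS R a, aS_mem_UU⟩
  let bC : CC R a taue := ⟨aS R a, UU_le_CC aS_mem_UU⟩
  let bA : AG R a tau := ⟨aS R a, algebraMap_mem_AG a⟩
  let iU : UU R a taue →+* RstarG R a := (UU R a taue).val.toRingHom
  let iC : CC R a taue →+* RstarG R a := (CC R a taue).val.toRingHom
  let iA : AG R a tau →+* RstarG R a := (AG R a tau).subtype
  have kU := pow_dvd_of_pow_dvd_map iU Subtype.val_injective bU <| by
    rintro y ⟨z, hz⟩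
    exact ⟨⟨y, hs.mem_UU_of_aS_mul_mem (hz ▸ z.2)⟩, rfl⟩
  have kC := pow_dvd_of_pow_dvd_map iC Subtype.val_injective bC <| by
    rintro y ⟨z, hz⟩
    exact ⟨⟨y, hs.mem_CC_of_aS_mul_mem (hz ▸ z.2)⟩, rfl⟩
  have kA := pow_dvd_of_pow_dvd_map iA Subtype.val_injective bA <| by
    rintro y ⟨z, hz⟩
    exact ⟨⟨y, mem_AG_of_aS_mul_mem hs.ha0 (hz ▸ z.2)⟩, rfl⟩
  have sR := exists_pow_dvd_sub_algebraMap R a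
  have sU : ∀ n y, ∃ x, iU bU ^ n ∣ y - iU x := fun n y =>
    (sR n y).imp' (fun r => ⟨_, algebraMap_mem _ r⟩) fun _ h => h
  have sC : ∀ n y, ∃ x, iC bC ^ n ∣ y - iC x := fun n y =>
    (sR n y).imp' (fun r => ⟨_, algebraMap_mem _ r⟩) fun _ h => h
  have sA : ∀ n y, ∃ x, iA bA ^ n ∣ y - iA x := fun n y =>
    (sR n y).imp' (fun r => ⟨_, algebraMap_mem_AG r⟩) fun _ h => h
  have eU : ∀ t, {w : UU R a taue | (w : RstarG R a) = aS R a ^ t} = {bU ^ t} := fun t =>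
    Set.ext fun w => ⟨fun h => Subtype.ext h, fun h => congrArg Subtype.val h⟩
  have eC : ∀ t, {w : CC R a taue | (w : RstarG R a) = aS R a ^ t} = {bC ^ t} := fun t =>
    Set.ext fun w => ⟨fun h => Subtype.ext h, fun h => congrArg Subtype.val h⟩
  have eA : ∀ t, {w : AG R a tau | (w : RstarG R a) = aS R a ^ t} = {bA ^ t} := fun t =>
    Set.ext fun w => ⟨fun h => Subtype.ext h, fun h => congrArg Subtype.val h⟩
  have : IsAdicComplete (Ideal.span {iU bU}) (RstarG R a) := isAdicComplete_span_aS R a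
  have : IsAdicComplete (Ideal.span {iC bC}) (RstarG R a) := isAdicComplete_span_aS R a
  have : IsAdicComplete (Ideal.span {iA bA}) (RstarG R a) := isAdicComplete_span_aS R a
  refine ⟨fun t _ => ?_, fun t _ D _ π hπ hk => ⟨?_, ?_, ?_, ?_⟩, ?_, ?_, ?_, hs.mem_jacobson_CC⟩
  · rw [eC]
    ext x
    rw [Ideal.mem_comap, Ideal.mem_span_singleton, Ideal.mem_span_singleton]
    exact ⟨fun h => map_pow iC bC t ▸ map_dvd iC h, kC t x⟩
  · exact surjective_and_ker_comp _ a t (pow_dvd_of_pow_dvd_algebraMap R a t) (sR t) π hπ hk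
  · rw [eU]
    exact surjective_and_ker_comp iU bU t (kU t) (sU t) π hπ hk
  · rw [eC]
    exact surjective_and_ker_comp iC bC t (kC t) (sC t) π hπ hk
  · rw [eA]
    exact surjective_and_ker_comp iA bA t (kA t) (sA t) π hπ hk
  · have e := eU 1
    simp only [pow_one] at e
    rw [e]
    exact nonempty_adicCompletion_equiv iU bU kU sU
  · have e := eC 1
    simp only [pow_one] at e
    rw [e]
    exact nonempty_adicCompletion_equiv iC bC kC sC
  · have e := eA 1
    simp only [pow_one] at e
    rw [e]
    exact nonempty_adicCompletion_equiv iA bA kA sA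

end HRWGen
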